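/- Let m be odd and let d be an odd integer with 2 ≤ d ≤ 2^m - 2 and gcd(d, 2^m - 1) = 1 such that the power function x ↦ x^d on F = GF(2^m) is maximum nonlinear. If there exists a quadratic form Q : F → GF(2) (where F is regarded as a vector space over GF(2)) such that D_d = {x ∈ F : Q(x) = 1}, then d = 2^k + 1 for some positive integer k with gcd(k, m) = 1. (In words: the only maximum nonlinear power mappings x^d for which D_d is a quadric are the Gold power mappings.) -/

import Mathlib

attribute [local instance] Classical.propDecidable

noncomputable instance (m : ℕ) : Fintype (GaloisField 2 m) := Fintype.ofFinite _

/-- The absolute trace map from `GF(2^m)` to `GF(2)`. -/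
noncomputable def tr (m : ℕ) (x : GaloisField 2 m) : ZMod 2 :=
  Algebra.trace (ZMod 2) (GaloisField 2 m) x

/-- `(-1)^t` as an integer, for `t ∈ GF(2)`. -/
def chi (t : ZMod 2) : ℤ := (-1) ^ t.val

/-- The Walsh coefficient `∑_{x ∈ F} (-1)^(tr(γx + βx^d))` of the power map `x ↦ x^d`. -/
noncomputable def walsh (m d : ℕ) (β γ : GaloisField 2 m) : ℤ :=
  ∑ x : GaloisField 2 m, chi (tr m (γ * x + β * x ^ d))

/-- The power function `x ↦ x^d` on `GF(2^m)` is maximum nonlinear (almost bent). -/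
def MaxNonlinear (m d : ℕ) : Prop :=
  ∀ β : GaloisField 2 m, β ≠ 0 → ∀ γ : GaloisField 2 m,
    walsh m d β γ ∈ ({0, 2 ^ ((m + 1) / 2), -(2 ^ ((m + 1) / 2))} : Set ℤ)

/-- `D_d = {x ∈ F : tr(x^d) = 1}`. -/
noncomputable def Dd (m d : ℕ) : Finset (GaloisField 2 m) :=
  Finset.univ.filter (fun x => tr m (x ^ d) = 1)

/-- `H^i(α) = {x ∈ F : tr(αx) = i}`. -/
noncomputable def Hi (m : ℕ) (α : GaloisField 2 m) (i : ZMod 2) :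
    Finset (GaloisField 2 m) :=
  Finset.univ.filter (fun x => tr m (α * x) = i)

/-- `H^{i,j}(α,β) = {x ∈ F : tr(αx) = i and tr(βx) = j}`. -/
noncomputable def Hij (m : ℕ) (α β : GaloisField 2 m) (i j : ZMod 2) :
    Finset (GaloisField 2 m) :=
  Finset.univ.filter (fun x => tr m (α * x) = i ∧ tr m (β * x) = j)

theorem chi_zero : chi 0 = 1 := by decide

theorem chi_one : chi 1 = -1 := by decide

theorem chi_add (a b : ZMod 2) : chi (a + b) = chi a * chi b := by
  revert a b; decide

theorem chi_mul_self (a : ZMod 2) : chi a * chi a = 1 := by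
  revert a; decide

theorem tr_zero (m : ℕ) : tr m 0 = 0 := map_zero _

theorem tr_add (m : ℕ) (x y : GaloisField 2 m) : tr m (x + y) = tr m x + tr m y :=
  map_add _ x y

theorem card_galoisField_two {m : ℕ} (hm : m ≠ 0) :
    Fintype.card (GaloisField 2 m) = 2 ^ m := by
  rw [← Nat.card_eq_fintype_card, GaloisField.card 2 m hm]

theorem algebraMap_tr {m : ℕ} (hm : m ≠ 0) (x : GaloisField 2 m) :
    algebraMap (ZMod 2) (GaloisField 2 m) (tr m x) = ∑ i ∈ Finset.range m, x ^ 2 ^ i := by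
  rw [tr, FiniteField.algebraMap_trace_eq_sum_pow, GaloisField.finrank 2 hm, Nat.card_zmod]

theorem tr_pow_two_pow {m : ℕ} (x : GaloisField 2 m) (k : ℕ) : tr m (x ^ 2 ^ k) = tr m x := by
  induction k with
  | zero => simp
  | succ k ih =>
    have h : ∀ y : GaloisField 2 m, tr m (y ^ 2) = tr m y := fun y => by
      have := Algebra.trace_eq_of_algEquiv
        (FiniteField.frobeniusAlgEquivOfAlgebraic (ZMod 2) (GaloisField 2 m)) y
      simpa [tr] using this
    rw [pow_succ, pow_mul, h, ih]

/-- The character sum of an additive map to `GF(2)` detects whether the map vanishes. -/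
theorem sum_chi_of_additive {m : ℕ} (hm : m ≠ 0) (φ : GaloisField 2 m → ZMod 2)
    (hφ : ∀ x y, φ (x + y) = φ x + φ y) :
    ∑ x, chi (φ x) = if ∀ x, φ x = 0 then 2 ^ m else 0 := by
  split_ifs with h
  · simp [h, chi_zero, card_galoisField_two hm]
  · push Not at h
    obtain ⟨y, hy⟩ := h
    have hy1 : φ y = 1 := by
      generalize φ y = a at hy
      revert hy; revert a; decide
    have : ∑ x, chi (φ x) = -∑ x, chi (φ x) := by
      rw [← Finset.sum_neg_distrib, ← Equiv.sum_comp (Equiv.addRight y)]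
      refine Finset.sum_congr rfl fun x _ => ?_
      simp [hφ, hy1, chi_add, chi_one]
    omega

/-- Some Walsh coefficient `∑ (-1)^(tr(γx + x^d))` does not vanish. -/
theorem exists_walsh_one_ne_zero {m d : ℕ} (hm : m ≠ 0) (hd : d ≠ 0) :
    ∃ γ, walsh m d 1 γ ≠ 0 := by
  by_contra! h
  have hsum : ∑ γ, walsh m d 1 γ = 2 ^ m := by
    simp only [walsh]
    rw [Finset.sum_comm, Finset.sum_eq_single 0]
    · simp [hd, tr_zero, chi_zero, card_galoisField_two hm]
    · intro x _ hx
      simp only [tr_add, chi_add]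
      rw [← Finset.sum_mul, sum_chi_of_additive hm (fun γ => tr m (γ * x))
        (fun a b => by rw [add_mul, tr_add]), if_neg, zero_mul]
      intro h0
      exact hx ((traceForm_nondegenerate (ZMod 2) (GaloisField 2 m)).1 x fun y => by
        rw [Algebra.traceForm_apply, mul_comm]
        exact h0 y)
    · simp
  simp [h] at hsum
  exact absurd hsum.symm (by positivity)

/-- The expansion of a quadratic form in the squared coordinates given by the trace form. -/
theorem exists_quadraticForm_eq_sum_tr {m : ℕ} (Q : QuadraticForm (ZMod 2) (GaloisField 2 m)) :
    ∃ (n : ℕ) (a : Fin n → GaloisField 2 m) (c : Fin n → Fin n → ZMod 2),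
      ∀ x, Q x = ∑ r, ∑ s, c r s * (tr m (a r * x) * tr m (a s * x)) := by
  obtain ⟨B, rfl⟩ := LinearMap.BilinMap.toQuadraticMap_surjective Q
  let b := Module.finBasis (ZMod 2) (GaloisField 2 m)
  let D := (Algebra.traceForm (ZMod 2) (GaloisField 2 m)).dualBasis
    (traceForm_nondegenerate (ZMod 2) (GaloisField 2 m)) b
  refine ⟨_, b, fun r s => B (D r) (D s), fun x => ?_⟩
  have hx : x = ∑ r, tr m (b r * x) • D r := by
    conv_lhs => rw [← D.sum_repr x]
    refine Finset.sum_congr rfl fun r _ => ?_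
    rw [LinearMap.BilinForm.dualBasis_repr_apply, Algebra.traceForm_apply, mul_comm, tr]
  rw [LinearMap.BilinMap.toQuadraticMap_apply]
  conv_lhs => rw [hx]
  simp only [map_sum, LinearMap.sum_apply, map_smul, LinearMap.smul_apply, smul_eq_mul]
  rw [Finset.sum_comm]
  refine Finset.sum_congr rfl fun r _ => ?_
  rw [Finset.mul_sum]
  exact Finset.sum_congr rfl fun s _ => by ring

/-- If `tr(x^d)` is a quadratic form, then `d` has binary weight at most two. -/
theorem exists_eq_two_pow_add_two_pow {m d : ℕ} (hd2 : 2 ≤ d) (hdle : d ≤ 2 ^ m - 2)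
    (hgcd : Nat.gcd d (2 ^ m - 1) = 1) (Q : QuadraticForm (ZMod 2) (GaloisField 2 m))
    (hQ : ∀ x, tr m (x ^ d) = Q x) :
    ∃ i < m, ∃ j < m, 2 ^ i + 2 ^ j = d := by
  have hm : m ≠ 0 := by rintro rfl; simp at hdle; omega
  have hcard := card_galoisField_two hm
  set n := 2 ^ m - 1 - d with hn
  by_contra! hne
  have hunits : ∀ e : ℕ, ∑ x : (GaloisField 2 m)ˣ, (x : GaloisField 2 m) ^ e =
      if 2 ^ m - 1 ∣ e then -1 else 0 := fun e => by
    rw [← hcard]; exact FiniteField.sum_pow_units _ e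
  have htrace : ∑ x : (GaloisField 2 m)ˣ,
      algebraMap (ZMod 2) (GaloisField 2 m) (tr m ((x : GaloisField 2 m) ^ d)) *
        (x : GaloisField 2 m) ^ n = -1 := by
    simp only [algebraMap_tr hm, Finset.sum_mul, ← pow_mul, ← pow_add]
    rw [Finset.sum_comm]
    simp only [hunits]
    rw [Finset.sum_eq_single 0]
    · rw [if_pos]
      exact ⟨1, by omega⟩
    · intro i hi hi0
      rw [if_neg]
      intro hdvd
      have hi' : 2 ^ i < 2 ^ m := Nat.pow_lt_pow_right (by norm_num) (Finset.mem_range.1 hi)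
      have hi1 : 1 < 2 ^ i := Nat.one_lt_two_pow hi0
      have he : d * 2 ^ i + n = d * (2 ^ i - 1) + (2 ^ m - 1) := by
        obtain ⟨t, ht⟩ : ∃ t, 2 ^ i = t + 1 := ⟨2 ^ i - 1, by omega⟩
        rw [ht, mul_add]
        simp only [Nat.add_sub_cancel]
        omega
      rw [he, Nat.dvd_add_left (dvd_refl _)] at hdvd
      have := Nat.le_of_dvd (by omega) ((Nat.Coprime.symm hgcd).dvd_of_dvd_mul_left hdvd)
      omega
    · intro h0
      exact absurd (Finset.mem_range.2 (Nat.pos_of_ne_zero hm)) h0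
  have hquad : ∑ x : (GaloisField 2 m)ˣ,
      algebraMap (ZMod 2) (GaloisField 2 m) (Q (x : GaloisField 2 m)) *
        (x : GaloisField 2 m) ^ n = 0 := by
    obtain ⟨N, a, c, hac⟩ := exists_quadraticForm_eq_sum_tr Q
    simp only [hac, map_sum, map_mul, algebraMap_tr hm, Finset.sum_mul, Finset.mul_sum]
    rw [Finset.sum_comm]
    refine Finset.sum_eq_zero fun r _ => ?_
    rw [Finset.sum_comm]
    refine Finset.sum_eq_zero fun s _ => ?_
    rw [Finset.sum_comm]
    refine Finset.sum_eq_zero fun i hi => ?_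
    rw [Finset.sum_comm]
    refine Finset.sum_eq_zero fun j hj => ?_
    rw [Finset.mem_range] at hi hj
    have hrw : ∀ C A A' x : GaloisField 2 m,
        C * ((A * x) ^ 2 ^ j * (A' * x) ^ 2 ^ i) * x ^ n =
          C * A ^ 2 ^ j * A' ^ 2 ^ i * x ^ (2 ^ i + 2 ^ j + n) := fun C A A' x => by ring
    have hnd : ¬ 2 ^ m - 1 ∣ 2 ^ i + 2 ^ j + n := by
      intro hdvd
      obtain ⟨p, rfl⟩ := Nat.exists_eq_succ_of_ne_zero hm
      have hi' : 2 ^ i ≤ 2 ^ p := Nat.pow_le_pow_right (by norm_num) (by omega)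
      have hj' : 2 ^ j ≤ 2 ^ p := Nat.pow_le_pow_right (by norm_num) (by omega)
      have hi1 : 1 ≤ 2 ^ i := Nat.one_le_two_pow
      have hj1 : 1 ≤ 2 ^ j := Nat.one_le_two_pow
      have hp : 2 ^ (p + 1) = 2 * 2 ^ p := by ring
      have hne' := hne i hi j hj
      obtain ⟨t, ht⟩ := hdvd
      have ht2 : t < 2 := by
        by_contra! h2
        have := Nat.mul_le_mul_left (2 ^ (p + 1) - 1) h2
        simp only [Nat.succ_eq_add_one] at *
        omega
      interval_cases t <;> simp only [Nat.succ_eq_add_one] at * <;> omega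
    simp only [hrw]
    rw [← Finset.mul_sum, hunits, if_neg hnd, mul_zero]
  simp only [hQ] at htrace
  rw [hquad] at htrace
  exact absurd htrace.symm (neg_ne_zero.2 one_ne_zero)

/-- The square of a nonzero Walsh coefficient of `x ↦ x^(2^k + 1)` is `2^m` times the size of the
radical of the polar form. -/
theorem walsh_gold_sq {m k : ℕ} (hm : m ≠ 0) (γ : GaloisField 2 m)
    (hγ : walsh m (2 ^ k + 1) 1 γ ≠ 0) :
    walsh m (2 ^ k + 1) 1 γ ^ 2 =
      ∑ u : GaloisField 2 m,
        if ∀ x : GaloisField 2 m, tr m (x ^ 2 ^ k * u + x * u ^ 2 ^ k) = 0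
        then 2 ^ m else 0 := by
  set W := walsh m (2 ^ k + 1) 1 γ with hW
  let t : GaloisField 2 m → ZMod 2 := fun x => tr m (γ * x + 1 * x ^ (2 ^ k + 1))
  let β : GaloisField 2 m → GaloisField 2 m → ZMod 2 :=
    fun u x => tr m (x ^ 2 ^ k * u + x * u ^ 2 ^ k)
  have hWt : W = ∑ x, chi (t x) := rfl
  have ht : ∀ x u, t (x + u) = t x + t u + β u x := fun x u => by
    simp only [t, β, ← tr_add]
    congr 1
    rw [pow_succ, add_pow_char_pow]
    ring
  have hβ : ∀ u x y, β u (x + y) = β u x + β u y := fun u x y => by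
    simp only [β, ← tr_add]
    congr 1
    rw [add_pow_char_pow]
    ring
  have hchi : ∀ u, (∀ x, β u x = 0) → chi (t u) = 1 := fun u hu => by
    have h1 : W = W * chi (t u) := by
      conv_lhs => rw [hWt, ← Equiv.sum_comp (Equiv.addRight u)]
      rw [hWt, Finset.sum_mul]
      refine Finset.sum_congr rfl fun x _ => ?_
      simp [ht, hu, chi_add]
    exact (mul_eq_left₀ hγ).1 h1.symm
  calc W ^ 2 = ∑ x, ∑ u, chi (t x) * chi (t (x + u)) := by
        rw [sq]
        conv_lhs => rw [hWt, Finset.sum_mul]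
        refine Finset.sum_congr rfl fun x _ => ?_
        rw [← Finset.mul_sum, ← Equiv.sum_comp (Equiv.addLeft x)]
        rfl
    _ = ∑ u, ∑ x, chi (t u) * chi (β u x) := by
        rw [Finset.sum_comm]
        refine Finset.sum_congr rfl fun u _ => Finset.sum_congr rfl fun x _ => ?_
        rw [ht, chi_add, chi_add, mul_assoc, ← mul_assoc, chi_mul_self, one_mul]
    _ = _ := by
        refine Finset.sum_congr rfl fun u _ => ?_
        rw [← Finset.mul_sum, sum_chi_of_additive hm (β u) (hβ u)]
        split_ifs with h
        · rw [hchi u h, one_mul]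
        · rw [mul_zero]

/-- If `gcd(k, m) > 1`, the map `x ↦ x^(2^k)` has a fixed point in `GF(2^m)` besides `0, 1`. -/
theorem exists_pow_two_pow_eq_self {m k : ℕ} (hm : m ≠ 0) (hk : Nat.gcd k m ≠ 1) :
    ∃ u : GaloisField 2 m, u ≠ 0 ∧ u ≠ 1 ∧ u ^ 2 ^ k = u := by
  have hg : 2 ≤ Nat.gcd k m := by
    have := Nat.gcd_pos_of_pos_right k (Nat.pos_of_ne_zero hm)
    omega
  obtain ⟨z, hz⟩ := IsCyclic.exists_ofOrder_eq_natCard (α := (GaloisField 2 m)ˣ)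
  have hzo : orderOf z = 2 ^ m - 1 := by
    rw [hz, Nat.card_units, GaloisField.card 2 m hm]
  obtain ⟨e, he⟩ := Nat.pow_sub_one_dvd_pow_sub_one 2 (Nat.gcd_dvd_right k m)
  obtain ⟨f, hf⟩ := Nat.pow_sub_one_dvd_pow_sub_one 2 (Nat.gcd_dvd_left k m)
  have h4 : 2 ^ 2 ≤ 2 ^ Nat.gcd k m := Nat.pow_le_pow_right (by norm_num) hg
  have hm2 : 1 < 2 ^ m := Nat.one_lt_two_pow hm
  have hz1 : (z ^ e) ^ (2 ^ k - 1) = 1 := by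
    rw [← pow_mul, ← orderOf_dvd_iff_pow_eq_one, hzo, hf, he]
    exact ⟨f, by ring⟩
  refine ⟨(z ^ e : (GaloisField 2 m)ˣ), Units.ne_zero _, ?_, ?_⟩
  · rw [Ne, Units.val_eq_one, ← orderOf_dvd_iff_pow_eq_one, hzo]
    intro hdvd
    have he0 : 0 < e := by
      rcases Nat.eq_zero_or_pos e with rfl | h
      · omega
      · exact h
    have := Nat.le_of_dvd he0 hdvd
    nlinarith [Nat.mul_le_mul_right e (show 3 ≤ 2 ^ Nat.gcd k m - 1 by omega)]
  · rw [← Units.val_pow_eq_pow_val, Units.val_inj]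
    have hk1 : 2 ^ k = 2 ^ k - 1 + 1 := by
      have : 1 ≤ 2 ^ k := Nat.one_le_two_pow
      omega
    rw [hk1, pow_succ, hz1, one_mul]

/-- A maximum nonlinear map `x ↦ x^(2^k + 1)` on `GF(2^m)` has `k` coprime to `m`. -/
theorem gcd_eq_one_of_maxNonlinear_gold {m k : ℕ} (hmodd : Odd m)
    (hmax : MaxNonlinear m (2 ^ k + 1)) : Nat.gcd k m = 1 := by
  by_contra hk
  have hm : m ≠ 0 := hmodd.pos.ne'
  obtain ⟨γ, hγ⟩ := exists_walsh_one_ne_zero (m := m) (d := 2 ^ k + 1) hm (Nat.succ_ne_zero _)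
  have hsq : walsh m (2 ^ k + 1) 1 γ ^ 2 = 2 * 2 ^ m := by
    obtain ⟨r, rfl⟩ := hmodd
    have hr : (2 * r + 1 + 1) / 2 = r + 1 := by omega
    have := hmax 1 one_ne_zero γ
    rw [hr] at this
    rcases this with h | h | h
    · exact absurd h hγ
    · rw [h]; ring
    · rw [h]; ring
  obtain ⟨u, hu0, hu1, huk⟩ := exists_pow_two_pow_eq_self hm hk
  have hrad : ∀ v : GaloisField 2 m, v ^ 2 ^ k = v →
      ∀ x : GaloisField 2 m, tr m (x ^ 2 ^ k * v + x * v ^ 2 ^ k) = 0 := fun v hv x => by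
    have : x ^ 2 ^ k * v = (x * v) ^ 2 ^ k := by rw [mul_pow, hv]
    rw [tr_add, this, tr_pow_two_pow, hv]
    exact CharTwo.add_self_eq_zero _
  rw [walsh_gold_sq hm γ hγ] at hsq
  have hle : ∑ v ∈ ({0, 1, u} : Finset (GaloisField 2 m)), (2 : ℤ) ^ m ≤ 2 * 2 ^ m := by
    rw [← hsq]
    refine le_trans (Finset.sum_le_sum fun v hv => ?_)
      (Finset.sum_le_sum_of_subset_of_nonneg (Finset.subset_univ _) fun v _ _ => ?_)
    · rw [if_pos]
      apply hrad
      simp only [Finset.mem_insert, Finset.mem_singleton] at hv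
      rcases hv with rfl | rfl | rfl
      · simp
      · simp
      · exact huk
    · split_ifs <;> positivity
  have hcard : ({0, 1, u} : Finset (GaloisField 2 m)).card = 3 :=
    Finset.card_eq_three.2 ⟨0, 1, u, zero_ne_one, hu0.symm, hu1.symm, rfl⟩
  rw [Finset.sum_const, hcard, nsmul_eq_mul] at hle
  have : (0 : ℤ) < 2 ^ m := by positivity
  push_cast at hle
  linarith

/-- The only maximum nonlinear power mappings `x ↦ x^d` on `GF(2^m)` (`m` odd,
`d` odd, `2 ≤ d ≤ 2^m - 2`, `gcd(d, 2^m - 1) = 1`) for which `D_d` is a quadric (the set of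
ones of a quadratic form on `GF(2^m)` over `GF(2)`) are the Gold power mappings. -/
theorem stmt5 (m : ℕ) (hmodd : Odd m) (d : ℕ) (hdodd : Odd d)
    (hd2 : 2 ≤ d) (hdle : d ≤ 2 ^ m - 2) (hgcd : Nat.gcd d (2 ^ m - 1) = 1)
    (hmax : MaxNonlinear m d)
    (hquad : ∃ Q : QuadraticForm (ZMod 2) (GaloisField 2 m),
      ∀ x : GaloisField 2 m, tr m (x ^ d) = 1 ↔ Q x = 1) :
    ∃ k : ℕ, 0 < k ∧ Nat.gcd k m = 1 ∧ d = 2 ^ k + 1 := by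
  obtain ⟨Q, hQ⟩ := hquad
  have hQ' : ∀ x, tr m (x ^ d) = Q x := fun x => by
    have h := hQ x
    generalize tr m (x ^ d) = a at h
    generalize Q x = b at h
    revert a b
    decide
  obtain ⟨i, -, j, -, hij⟩ := exists_eq_two_pow_add_two_pow hd2 hdle hgcd Q hQ'
  have hgold : ∃ k, 0 < k ∧ d = 2 ^ k + 1 := by
    rcases Nat.eq_zero_or_pos i with rfl | hi <;> rcases Nat.eq_zero_or_pos j with rfl | hj
    · subst hij
      exact absurd hdodd (by decide)
    · exact ⟨j, hj, by rw [← hij, pow_zero, add_comm]⟩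
    · exact ⟨i, hi, by rw [← hij, pow_zero]⟩
    · exact absurd hdodd (by
        rw [Nat.not_odd_iff_even, ← hij]
        exact (even_two.pow_of_ne_zero hi.ne').add (even_two.pow_of_ne_zero hj.ne'))
  obtain ⟨k, hk, rfl⟩ := hgold
  exact ⟨k, hk, gcd_eq_one_of_maxNonlinear_gold hmodd hmax, rfl⟩
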